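/- (Sevastianov) In any open shop instance, if the maximum machine load satisfies ℓ_max ≥ m² · p_max, then there exists a feasible schedule with makespan exactly ℓ_max; consequently, the minimum makespan over all feasible schedules equals ℓ_max. -/

import Mathlib

/-- A feasible open shop schedule: `s i j` is the start time of the operation of job `j`
on machine `i` (only relevant when `p i j > 0`). On each machine, the processing
intervals of distinct jobs are disjoint, and each job is processed by at most one
machine at a time. -/
def OSFeasible (m n : ℕ) (p s : Fin m → Fin n → ℕ) : Prop :=
  (∀ i : Fin m, ∀ j j' : Fin n, j ≠ j' → 0 < p i j → 0 < p i j' →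
      Disjoint (Set.Ico (s i j) (s i j + p i j)) (Set.Ico (s i j') (s i j' + p i j'))) ∧
  (∀ j : Fin n, ∀ i i' : Fin m, i ≠ i' → 0 < p i j → 0 < p i' j →
      Disjoint (Set.Ico (s i j) (s i j + p i j)) (Set.Ico (s i' j) (s i' j + p i' j)))

/-- The makespan of an open shop schedule: the maximum completion time of an
operation with positive processing time (0 if there are none). -/
def OSMakespan (m n : ℕ) (p s : Fin m → Fin n → ℕ) : ℕ :=
  Finset.univ.sup fun ij : Fin m × Fin n =>
    if 0 < p ij.1 ij.2 then s ij.1 ij.2 + p ij.1 ij.2 else 0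

/-- The maximum machine load `ℓ_max = max_i Σ_j p i j`. -/
def OSMaxLoad (m n : ℕ) (p : Fin m → Fin n → ℕ) : ℕ :=
  Finset.univ.sup fun i : Fin m => ∑ j, p i j

/-- The maximum processing time `p_max = max_{i,j} p i j`. -/
def OSPMax (m n : ℕ) (p : Fin m → Fin n → ℕ) : ℕ :=
  Finset.univ.sup fun ij : Fin m × Fin n => p ij.1 ij.2

/-- A linear functional on a box cut by `r` linear equations has a minimizer with at most `r`
coordinates strictly between their bounds. -/
theorem exists_basic_minimizer {J : Type*} [Fintype J] {r : ℕ}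
    (M : (J → ℝ) →ₗ[ℝ] (Fin r → ℝ)) (c : (J → ℝ) →ₗ[ℝ] ℝ) (u : J → ℝ) (b : Fin r → ℝ)
    (hne : ∃ x ∈ Set.Icc 0 u, M x = b) :
    ∃ x ∈ Set.Icc 0 u, M x = b ∧ (∀ y ∈ Set.Icc 0 u, M y = b → c x ≤ c y) ∧
      (Finset.univ.filter fun j => 0 < x j ∧ x j < u j).card ≤ r := by
  classical
  have hMc : Continuous M := M.continuous_of_finiteDimensional
  have hcc : Continuous c := c.continuous_of_finiteDimensional
  have hX : IsCompact (Set.Icc 0 u ∩ {x | M x = b}) :=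
    isCompact_Icc.inter_right (isClosed_eq hMc continuous_const)
  obtain ⟨x₀, hx₀, hmin⟩ := hX.exists_isMinOn
    (by obtain ⟨x, hx, hb⟩ := hne; exact ⟨x, hx, hb⟩) hcc.continuousOn
  have hS : IsCompact ((Set.Icc 0 u ∩ {x | M x = b}) ∩ {x | c x = c x₀}) :=
    hX.inter_right (isClosed_eq hcc continuous_const)
  obtain ⟨x, hx⟩ := hS.extremePoints_nonempty ⟨x₀, hx₀, rfl⟩
  obtain ⟨⟨⟨hxI, hxM⟩, hxc⟩, hext⟩ := mem_extremePoints.1 hx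
  change M x = b at hxM
  change c x = c x₀ at hxc
  have hopt : ∀ y ∈ Set.Icc 0 u, M y = b → c x ≤ c y := fun y hy hyb =>
    hxc ▸ hmin ⟨hy, hyb⟩
  refine ⟨x, hxI, hxM, hopt, ?_⟩
  by_contra! hcard
  let E := Function.ExtendByZero.linearMap ℝ
    (Subtype.val : {j // 0 < x j ∧ x j < u j} → J)
  have hker : LinearMap.ker (M ∘ₗ E) ≠ ⊥ := by
    apply LinearMap.ker_ne_bot_of_finrank_lt
    simpa [Fintype.card_subtype] using hcard
  obtain ⟨v, hv, hv0⟩ := Submodule.exists_mem_ne_zero_of_ne_bot hker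
  have hMw : M (E v) = 0 := hv
  have hw0 : E v ≠ 0 := by
    intro h
    apply hv0
    funext j
    have := congrFun h j.1
    simpa [E, Subtype.val_injective.extend_apply] using this
  have hwsupp : ∀ j, ¬ (0 < x j ∧ x j < u j) → E v j = 0 := by
    intro j hj
    have : ¬ ∃ a : {j // 0 < x j ∧ x j < u j}, a.1 = j := by
      rintro ⟨a, rfl⟩; exact hj a.2
    simp [E, Function.extend_apply' _ _ _ this]
  generalize E v = w at hMw hw0 hwsupp
  have hev : ∀ᶠ e : ℝ in nhdsWithin 0 (Set.Ioi 0),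
      ∀ j, (0 ≤ x j + e * w j ∧ x j + e * w j ≤ u j) ∧
        (0 ≤ x j - e * w j ∧ x j - e * w j ≤ u j) := by
    rw [Filter.eventually_all]
    intro j
    apply Filter.Eventually.filter_mono nhdsWithin_le_nhds
    by_cases hj : 0 < x j ∧ x j < u j
    · have hp : Filter.Tendsto (fun e : ℝ => x j + e * w j) (nhds 0) (nhds (x j)) := by
        have : Continuous fun e : ℝ => x j + e * w j := by fun_prop
        simpa using this.tendsto 0
      have hm : Filter.Tendsto (fun e : ℝ => x j - e * w j) (nhds 0) (nhds (x j)) := by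
        have : Continuous fun e : ℝ => x j - e * w j := by fun_prop
        simpa using this.tendsto 0
      filter_upwards [hp.eventually_const_le hj.1, hp.eventually_le_const hj.2,
        hm.eventually_const_le hj.1, hm.eventually_le_const hj.2] with e h1 h2 h3 h4
      exact ⟨⟨h1, h2⟩, h3, h4⟩
    · refine Filter.Eventually.of_forall fun e => ?_
      have h1 : 0 ≤ x j := hxI.1 j
      have h2 : x j ≤ u j := hxI.2 j
      simp [hwsupp j hj, h1, h2]
  obtain ⟨e, he, he0⟩ := (hev.and self_mem_nhdsWithin).exists
  replace he0 : 0 < e := he0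
  have hyp : x + e • w ∈ Set.Icc 0 u := ⟨fun j => (he j).1.1, fun j => (he j).1.2⟩
  have hym : x - e • w ∈ Set.Icc 0 u := ⟨fun j => (he j).2.1, fun j => (he j).2.2⟩
  have hMp : M (x + e • w) = b := by simp [hMw, hxM]
  have hMm : M (x - e • w) = b := by simp [hMw, hxM]
  have hcp := hopt _ hyp hMp
  have hcm := hopt _ hym hMm
  have hcw : e * c w = 0 := by
    simp only [map_add, map_sub, map_smul, smul_eq_mul] at hcp hcm
    linarith
  have h1 := hext (x + e • w) ⟨⟨hyp, hMp⟩, by simp [hcw, hxc]⟩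
    (x - e • w) ⟨⟨hym, hMm⟩, by simp [hcw, hxc]⟩
    ⟨1 / 2, 1 / 2, by norm_num, by norm_num, by norm_num, by
      rw [← smul_add]; funext j; simp; ring⟩
  have : e • w = 0 := by simpa using h1
  rcases smul_eq_zero.1 this with h | h
  · exact he0.ne' h
  · exact hw0 h

/-- Fractional weights on the jobs of `A` that give the same load to every machine. -/
structure BalancedWeights {m : ℕ} {J : Type*} [Fintype J] (p : Fin m → J → ℝ) (A : Finset J)
    (w : J → ℝ) : Prop where
  nonneg : ∀ j, 0 ≤ w j
  le_one : ∀ j, w j ≤ 1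
  support : ∀ j, j ∉ A → w j = 0
  balanced : ∀ i i', ∑ j, w j * p i j = ∑ j, w j * p i' j

namespace BalancedWeights

variable {m : ℕ} {J : Type*} [Fintype J] {p : Fin m → J → ℝ} {A : Finset J} {w : J → ℝ}

theorem mono {B : Finset J} (hw : BalancedWeights p A w) (h : ∀ j ∈ A, j ∉ B → w j = 0) :
    BalancedWeights p B w where
  nonneg := hw.nonneg
  le_one := hw.le_one
  support := fun j hj => by
    by_cases hA : j ∈ A
    · exact h j hA hj
    · exact hw.support j hA
  balanced := hw.balanced

theorem zero : BalancedWeights p A 0 :=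
  ⟨fun _ => le_rfl, fun _ => zero_le_one, fun _ _ => rfl, fun _ _ => by simp⟩

theorem sum_univ (hw : BalancedWeights p A w) : ∑ j, w j = ∑ j ∈ A, w j :=
  (Finset.sum_subset (Finset.subset_univ A) fun j _ hj => hw.support j hj).symm

theorem smul (hw : BalancedWeights p A w) {t : ℝ} (h0 : 0 ≤ t) (h1 : t ≤ 1) :
    BalancedWeights p A (fun j => t * w j) where
  nonneg := fun j => mul_nonneg h0 (hw.nonneg j)
  le_one := fun j => mul_le_one₀ h1 (hw.nonneg j) (hw.le_one j)
  support := fun j hj => by simp [hw.support j hj]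
  balanced := fun i i' => by
    simp only [mul_assoc, ← Finset.mul_sum, hw.balanced i i']

/-- Scaling balanced weights down to a smaller positive total and passing to a basic solution
leaves at most `m` fractional weights; the weight of one chosen job can be kept from growing. -/
theorem exists_basic (hm : 1 ≤ m) (hw : BalancedWeights p A w) {l : ℝ} (hl : 0 < l)
    (hlw : l ≤ ∑ j ∈ A, w j) (f : J) :
    ∃ v, BalancedWeights p A v ∧ ∑ j ∈ A, v j = l ∧ v f ≤ w f ∧
      (A.filter fun j => 0 < v j ∧ v j < 1).card ≤ m := by
  classical
  let z : Fin m := ⟨0, hm⟩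
  let M : (J → ℝ) →ₗ[ℝ] (Fin m → ℝ) :=
    { toFun := fun v i => if i = z then ∑ j, v j else ∑ j, v j * (p i j - p z j)
      map_add' := fun v v' => by
        funext i
        by_cases h : i = z <;> simp [h, Finset.sum_add_distrib, add_mul]
      map_smul' := fun t v => by
        funext i
        by_cases h : i = z <;> simp [h, Finset.mul_sum, mul_assoc] }
  let u : J → ℝ := fun j => if j ∈ A then 1 else 0
  let b : Fin m → ℝ := fun i => if i = z then l else 0
  have hM : ∀ v, BalancedWeights p A v → ∑ j ∈ A, v j = l → v ∈ Set.Icc 0 u ∧ M v = b := by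
    intro v hv hvl
    refine ⟨⟨hv.nonneg, fun j => ?_⟩, ?_⟩
    · by_cases hj : j ∈ A
      · simpa [u, hj] using hv.le_one j
      · simp [u, hj, hv.support j hj]
    · funext i
      by_cases hi : i = z
      · simp [M, b, hi, hv.sum_univ, hvl]
      · simp [M, b, hi, mul_sub, hv.balanced i z]
  have hs : 0 < ∑ j ∈ A, w j := hl.trans_le hlw
  have ht0 : 0 ≤ l / ∑ j ∈ A, w j := (div_pos hl hs).le
  have ht1 : l / ∑ j ∈ A, w j ≤ 1 := (div_le_one hs).2 hlw
  have hsc := hw.smul ht0 ht1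
  have hscl : ∑ j ∈ A, l / (∑ j ∈ A, w j) * w j = l := by
    rw [← Finset.mul_sum, div_mul_cancel₀ _ hs.ne']
  obtain ⟨v, hv, hvM, hmin, hcard⟩ := exists_basic_minimizer M (LinearMap.proj f) u b
    ⟨_, hM _ hsc hscl⟩
  have hsupp : ∀ j, j ∉ A → v j = 0 := fun j hj =>
    le_antisymm (by simpa [u, hj] using hv.2 j) (hv.1 j)
  have hvb : BalancedWeights p A v := by
    refine ⟨hv.1, fun j => (hv.2 j).trans ?_, hsupp, ?_⟩
    · by_cases hj : j ∈ A <;> simp [u, hj]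
    · have key : ∀ i, ∑ j, v j * p i j = ∑ j, v j * p z j := by
        intro i
        by_cases hi : i = z
        · rw [hi]
        · have := congrFun hvM i
          simp only [M, b, LinearMap.coe_mk, AddHom.coe_mk, if_neg hi, mul_sub,
            Finset.sum_sub_distrib] at this
          linarith
      intro i i'
      rw [key i, key i']
  refine ⟨v, hvb, ?_, ?_, ?_⟩
  · rw [← hvb.sum_univ]
    simpa [M, b] using congrFun hvM z
  · have := hmin _ (hM _ hsc hscl).1 (hM _ hsc hscl).2
    simp only [LinearMap.proj_apply] at this
    exact this.trans (mul_le_of_le_one_left (hw.nonneg f) ht1)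
  · refine le_trans (Finset.card_le_card fun j hj => ?_) hcard
    rw [Finset.mem_filter] at hj ⊢
    simpa [u, hj.1] using hj.2

/-- The lead of one machine (after job `q`) over another (before job `q`) is controlled by the
distance from the set of the jobs processed so far to any balanced weights. -/
theorem lead_le [DecidableEq J] {P E : ℝ} (hp0 : ∀ i j, 0 ≤ p i j) (hpP : ∀ i j, p i j ≤ P)
    {B : Finset J} (hw : BalancedWeights p A w) {q : J} (hq : q ∈ B)
    (hE : ∑ j ∈ B.erase q, (1 - w j) + ∑ j ∈ Bᶜ, w j ≤ E) (i i' : Fin m) :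
    ∑ j ∈ B, p i j - ∑ j ∈ B.erase q, p i' j ≤ (E + 1) * P := by
  have hP : 0 ≤ P := (hp0 i q).trans (hpP i q)
  have hbal := hw.balanced i i'
  rw [← Finset.sum_add_sum_compl B, ← Finset.sum_add_sum_compl B,
    ← Finset.add_sum_erase B _ hq, ← Finset.add_sum_erase B _ hq] at hbal
  have h1 : ∑ j ∈ B.erase q, ((1 - w j) * p i j - (1 - w j) * p i' j)
      ≤ ∑ j ∈ B.erase q, (1 - w j) * P := by
    refine Finset.sum_le_sum fun j _ => ?_
    rw [← mul_sub]
    refine mul_le_mul_of_nonneg_left ?_ (by linarith [hw.le_one j])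
    linarith [hp0 i' j, hpP i j]
  have h2 : ∑ j ∈ Bᶜ, (w j * p i' j - w j * p i j) ≤ ∑ j ∈ Bᶜ, w j * P := by
    refine Finset.sum_le_sum fun j _ => ?_
    rw [← mul_sub]
    refine mul_le_mul_of_nonneg_left ?_ (hw.nonneg j)
    linarith [hp0 i j, hpP i' j]
  have h3 : (1 - w q) * p i q + w q * p i' q ≤ P := by
    have := mul_le_mul_of_nonneg_left (hpP i q) (sub_nonneg.2 (hw.le_one q))
    have := mul_le_mul_of_nonneg_left (hpP i' q) (hw.nonneg q)
    linarith
  have h4 := mul_le_mul_of_nonneg_right hE hP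
  rw [add_mul, Finset.sum_mul, Finset.sum_mul] at h4
  rw [← Finset.add_sum_erase B _ hq]
  simp only [sub_mul, one_mul, Finset.sum_sub_distrib] at h1 h2 h3 h4
  linarith

end BalancedWeights

/-- The jobs of `A` can be ordered so that no machine leads another by more than `K`. -/
def HasCompactOrder {m : ℕ} {J : Type*} [DecidableEq J] (p : Fin m → J → ℝ) (K : ℝ)
    (A : Finset J) : Prop :=
  ∃ e : ℕ → J, (Finset.range A.card).image e = A ∧ ∀ k < A.card, ∀ i i',
    ∑ t ∈ Finset.range (k + 1), p i (e t) - ∑ t ∈ Finset.range k, p i' (e t) ≤ K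

theorem HasCompactOrder.of_erase {m : ℕ} {J : Type*} [DecidableEq J] {p : Fin m → J → ℝ}
    {K : ℝ} {A : Finset J} {q : J} (h : HasCompactOrder p K (A.erase q)) (hq : q ∈ A)
    (hK : ∀ i i', ∑ j ∈ A, p i j - ∑ j ∈ A.erase q, p i' j ≤ K) : HasCompactOrder p K A := by
  obtain ⟨e, he, hlead⟩ := h
  have hcard : A.card = (A.erase q).card + 1 := (Finset.card_erase_add_one hq).symm
  set N := (A.erase q).card with hN
  have hinj : Set.InjOn e (Finset.range N) := by
    rw [← Finset.card_image_iff, he, Finset.card_range]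
  have hupd : ∀ t ∈ Finset.range N, Function.update e N q t = e t := fun t ht =>
    Function.update_of_ne (Finset.mem_range.1 ht).ne _ _
  have hsum : ∀ k ≤ N, ∀ i, ∑ t ∈ Finset.range k, p i (Function.update e N q t)
      = ∑ t ∈ Finset.range k, p i (e t) := fun k hk i =>
    Finset.sum_congr rfl fun t ht => by rw [hupd t (Finset.range_subset_range.2 hk ht)]
  have hall : ∀ i, ∑ t ∈ Finset.range N, p i (e t) = ∑ j ∈ A.erase q, p i j := fun i => by
    conv_rhs => rw [← he]
    rw [Finset.sum_image hinj]
  refine ⟨Function.update e N q, ?_, ?_⟩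
  · rw [hcard, Finset.range_add_one, Finset.image_insert, Function.update_self,
      Finset.image_congr (g := e) (fun t ht => hupd t ht), he, Finset.insert_erase hq]
  · intro k hk i i'
    rw [hcard, Nat.lt_succ_iff_lt_or_eq] at hk
    rcases hk with hk | rfl
    · rw [hsum _ hk, hsum _ hk.le]
      exact hlead k hk i i'
    · rw [Finset.sum_range_succ, hsum _ le_rfl, hsum _ le_rfl, Function.update_self, hall, hall,
        Finset.sum_erase_add _ _ hq]
      exact hK i i'

theorem sum_one_sub_le_card_fractional {J : Type*} {B : Finset J} {v : J → ℝ} {t : ℝ}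
    (ht : 0 ≤ t) (h1 : ∀ j, v j ≤ 1) (h0 : ∀ j ∈ B, t < v j) :
    ∑ j ∈ B, (1 - v j) ≤ (B.filter fun j => 0 < v j ∧ v j < 1).card * (1 - t) ∧
    ((B.filter fun j => 0 < v j ∧ v j < 1).Nonempty →
      ∑ j ∈ B, (1 - v j) < (B.filter fun j => 0 < v j ∧ v j < 1).card * (1 - t)) := by
  have hsum : ∑ j ∈ B.filter (fun j => 0 < v j ∧ v j < 1), (1 - v j) = ∑ j ∈ B, (1 - v j) := by
    refine Finset.sum_subset (Finset.filter_subset _ _) fun j hj hjf => ?_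
    rw [Finset.mem_filter, not_and, not_and, not_lt] at hjf
    linarith [hjf hj (ht.trans_lt (h0 j hj)), h1 j]
  have hlt : ∀ j ∈ B.filter (fun j => 0 < v j ∧ v j < 1), 1 - v j < 1 - t := fun j hj => by
    linarith [h0 j (Finset.mem_filter.1 hj).1]
  rw [← hsum, ← nsmul_eq_mul]
  exact ⟨Finset.sum_le_card_nsmul _ _ _ fun j hj => (hlt j hj).le, fun hne =>
    (Finset.sum_lt_sum_of_nonempty hne hlt).trans_eq (Finset.sum_const _)⟩

theorem hasCompactOrder_of_balancedWeights {m : ℕ} (hm : 2 ≤ m) {J : Type*} [Fintype J]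
    [DecidableEq J] [Nonempty J] {p : Fin m → J → ℝ} {P : ℝ} (hp0 : ∀ i j, 0 ≤ p i j)
    (hpP : ∀ i j, p i j ≤ P) (N : ℕ) :
    (∀ (A : Finset J) (w : J → ℝ), A.card = N → BalancedWeights p A w →
      (N : ℝ) - (m - 1) ≤ ∑ j ∈ A, w j → HasCompactOrder p ((m - 2 + 2 / m + 1) * P) A) ∧
    (∀ (B : Finset J) (f : J) (w : J → ℝ), B.card = N → f ∉ B →
      BalancedWeights p (insert f B) w → (N : ℝ) - (m - 1) ≤ ∑ j ∈ insert f B, w j →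
      w f ≤ 1 / m → HasCompactOrder p ((m - 2 + 2 / m + 1) * P) B) := by
  have hm' : (2 : ℝ) ≤ m := by exact_mod_cast hm
  have hm0 : (0 : ℝ) < 1 / m := by positivity
  have hm2 : (2 : ℝ) / m = 1 / m + 1 / m := by ring
  induction N with
  | zero =>
    have key : HasCompactOrder p ((m - 2 + 2 / m + 1) * P) ∅ :=
      ⟨fun _ => Classical.arbitrary J, by simp, by simp⟩
    exact ⟨fun A w hA _ _ => by rwa [Finset.card_eq_zero.1 hA],
      fun B f w hB _ _ _ _ => by rwa [Finset.card_eq_zero.1 hB]⟩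
  | succ N ih =>
    have hpure : ∀ (A : Finset J) (w : J → ℝ), A.card = N + 1 → BalancedWeights p A w →
        ((N + 1 : ℕ) : ℝ) - (m - 1) ≤ ∑ j ∈ A, w j →
        HasCompactOrder p ((m - 2 + 2 / m + 1) * P) A := by
      intro A w hA hw hsum
      rcases le_or_gt (N + 2) m with hNm | hNm
      · obtain ⟨q, hq⟩ : A.Nonempty := Finset.card_pos.1 (by omega)
        have hNm' : (N : ℝ) + 2 ≤ m := by exact_mod_cast hNm
        have hcard : (A.erase q).card = N := by rw [Finset.card_erase_of_mem hq, hA]; rfl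
        refine HasCompactOrder.of_erase (ih.1 (A.erase q) 0 hcard .zero ?_) hq fun i i' =>
          BalancedWeights.lead_le (A := A) hp0 hpP .zero hq ?_ i i'
        · simp; linarith
        · simp [hcard]; linarith
      · have hNm' : (m : ℝ) < N + 2 := by exact_mod_cast hNm
        push_cast at hsum
        obtain ⟨f, -⟩ : A.Nonempty := Finset.card_pos.1 (by omega)
        obtain ⟨v, hv, hvl, -, hfrac⟩ := hw.exists_basic (by omega)
          (l := N + 1 - (m - 1)) (by linarith) hsum f
        have hone : ∑ j ∈ A, (1 - v j) = m - 1 := by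
          rw [Finset.sum_sub_distrib, hvl]; simp [hA]
        obtain ⟨q, hq, hqm⟩ : ∃ q ∈ A, v q ≤ 1 / m := by
          by_contra! hcon
          obtain ⟨hle, hlt⟩ := sum_one_sub_le_card_fractional hm0.le hv.le_one hcon
          rcases Finset.eq_empty_or_nonempty (A.filter fun j => 0 < v j ∧ v j < 1) with he | he
          · rw [he, hone] at hle
            simp at hle
            linarith
          · have h1 : (1 : ℝ) / m ≤ 1 := (div_le_one (by linarith)).2 (by linarith)
            have h2 : ((A.filter fun j => 0 < v j ∧ v j < 1).card : ℝ) ≤ m := by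
              exact_mod_cast hfrac
            have h3 := (hlt he).trans_le (mul_le_mul_of_nonneg_right h2 (sub_nonneg.2 h1))
            have h4 : (m : ℝ) * (1 - 1 / m) = m - 1 := by field_simp
            linarith
        have hcard : (A.erase q).card = N := by rw [Finset.card_erase_of_mem hq, hA]; rfl
        refine HasCompactOrder.of_erase (ih.2 (A.erase q) q v hcard (Finset.notMem_erase q A)
          (by rwa [Finset.insert_erase hq]) ?_ hqm) hq fun i i' =>
          hv.lead_le hp0 hpP hq ?_ i i'
        · rw [Finset.insert_erase hq, hvl]; linarith
        · rw [Finset.sum_eq_zero fun j hj => hv.support j (Finset.mem_compl.1 hj)]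
          rw [← Finset.add_sum_erase A _ hq] at hone
          linarith
    refine ⟨hpure, fun B f w hB hf hw hsum hwf => ?_⟩
    rcases le_or_gt (N + 2) m with hNm | hNm
    · have hNm' : (N : ℝ) + 2 ≤ m := by exact_mod_cast hNm
      exact hpure B 0 hB .zero (by simp; linarith)
    have hNm' : (m : ℝ) < N + 2 := by exact_mod_cast hNm
    push_cast at hsum
    obtain ⟨v, hv, hvl, hvf, hfrac⟩ := hw.exists_basic (by omega)
      (l := N + 1 - (m - 1)) (by linarith) hsum f
    rw [Finset.sum_insert hf] at hvl
    rcases (hv.nonneg f).eq_or_lt with hf0 | hf0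
    · refine hpure B v hB (hv.mono fun j hj hjB => ?_) (by push_cast; linarith)
      rw [(Finset.mem_insert.1 hj).resolve_right hjB, hf0]
    have hone : ∑ j ∈ B, (1 - v j) = m - 1 + v f := by
      rw [Finset.sum_sub_distrib]; simp [hB]; linarith
    have hf1 : v f < 1 := by
      have : (1 : ℝ) / m ≤ 1 / 2 := one_div_le_one_div_of_le (by norm_num) hm'
      linarith
    obtain ⟨q, hq, hq0⟩ : ∃ q ∈ B, v q ≤ 0 := by
      by_contra! hcon
      have hle := (sum_one_sub_le_card_fractional le_rfl hv.le_one hcon).1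
      rw [Finset.filter_insert, if_pos ⟨hf0, hf1⟩, Finset.card_insert_of_notMem
        (fun h => hf (Finset.mem_filter.1 h).1)] at hfrac
      have : ((B.filter fun j => 0 < v j ∧ v j < 1).card : ℝ) + 1 ≤ m := by exact_mod_cast hfrac
      linarith
    have hq0' : v q = 0 := le_antisymm hq0 (hv.nonneg q)
    have hqf : q ≠ f := fun h => hf (h ▸ hq)
    have hcard : (B.erase q).card = N := by rw [Finset.card_erase_of_mem hq, hB]; rfl
    have hf' : f ∉ B.erase q := fun h => hf (Finset.mem_of_mem_erase h)
    refine HasCompactOrder.of_erase (ih.2 (B.erase q) f v hcard hf'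
      (hv.mono fun j hj hjB => ?_) ?_ (hvf.trans hwf)) hq fun i i' =>
      hv.lead_le hp0 hpP hq ?_ i i'
    · simp only [Finset.mem_insert, Finset.mem_erase, not_or, not_and] at hj hjB
      rw [show j = q by tauto, hq0']
    · rw [Finset.sum_insert hf', Finset.sum_erase _ hq0']
      linarith
    · have hcompl : ∑ j ∈ Bᶜ, v j = v f :=
        Finset.sum_eq_single_of_mem f (Finset.mem_compl.2 hf) fun j hj hjf =>
          hv.support j (by simpa [hjf] using hj)
      rw [← Finset.add_sum_erase B _ hq, hq0'] at hone
      linarith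

/-- If all machines have the same load, the jobs can be ordered so that no machine leads
another by more than `m - 1 + 2 / m` times the maximum processing time. -/
theorem exists_compact_order {m : ℕ} (hm : 2 ≤ m) {J : Type*} [Fintype J] [Nonempty J]
    {p : Fin m → J → ℕ} {P L : ℕ} (hpP : ∀ i j, p i j ≤ P) (hload : ∀ i, ∑ j, p i j = L) :
    ∃ e : ℕ → J, (∀ j, ∃ k < Fintype.card J, e k = j) ∧
      (∀ i, ∑ t ∈ Finset.range (Fintype.card J), p i (e t) = L) ∧
      ∀ k < Fintype.card J, ∀ i i',
      m * (∑ t ∈ Finset.range (k + 1), p i (e t)) ≤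
        m * (∑ t ∈ Finset.range k, p i' (e t)) + (m * (m - 1) + 2) * P := by
  classical
  obtain ⟨e, he, hlead⟩ := (hasCompactOrder_of_balancedWeights hm
    (p := fun i j => (p i j : ℝ)) (P := P) (fun i j => Nat.cast_nonneg _)
    (fun i j => by exact_mod_cast hpP i j) (Fintype.card J)).1 Finset.univ 1 Finset.card_univ
    ⟨fun _ => zero_le_one, fun _ => le_rfl, by simp, fun i i' => by
      simp only [Pi.one_apply, one_mul]
      exact_mod_cast (hload i).trans (hload i').symm⟩ (by
      have : (2 : ℝ) ≤ m := by exact_mod_cast hm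
      simp; linarith)
  rw [Finset.card_univ] at he hlead
  refine ⟨e, fun j => ?_, fun i => ?_, fun k hk i i' => ?_⟩
  · obtain ⟨k, hk, rfl⟩ := Finset.mem_image.1 (he ▸ Finset.mem_univ j)
    exact ⟨k, Finset.mem_range.1 hk, rfl⟩
  · rw [← hload i, ← he, Finset.sum_image]
    rw [← Finset.card_image_iff, he, Finset.card_range, Finset.card_univ]
  · have h := hlead k hk i i'
    have hm0 : (0 : ℝ) < m := by positivity
    have h2 := mul_le_mul_of_nonneg_left h hm0.le
    have h3 : (m : ℝ) * ((m - 2 + 2 / m + 1) * P) = (m * (m - 1) + 2) * P := by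
      field_simp; ring
    rw [h3, mul_sub] at h2
    have h4 : ((m - 1 : ℕ) : ℝ) = m - 1 := by push_cast [Nat.cast_sub (show 1 ≤ m by omega)]; ring
    have : (m : ℝ) * (∑ t ∈ Finset.range (k + 1), (p i (e t) : ℝ)) ≤
        m * (∑ t ∈ Finset.range k, (p i' (e t) : ℝ)) + (m * ((m - 1 : ℕ) : ℝ) + 2) * P := by
      rw [h4]; linarith
    exact_mod_cast this

theorem disjoint_Ico_emod {x y : ℤ} {p q L : ℕ} (h1 : x + p ≤ y) (h2 : y + q ≤ x + L) :
    Disjoint (Set.Ico (x % L).toNat ((x % L).toNat + p))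
      (Set.Ico (y % L).toNat ((y % L).toNat + q)) := by
  rw [Set.disjoint_left]
  rintro t ⟨hx, hxp⟩ ⟨hy, hyq⟩
  have hL : (0 : ℤ) < L := by omega
  have hx0 := Int.emod_nonneg x hL.ne'
  have hy0 := Int.emod_nonneg y hL.ne'
  have hxd := Int.mul_ediv_add_emod x L
  have hyd := Int.mul_ediv_add_emod y L
  have hlo : (L : ℤ) * 0 < L * (y / L - x / L) := by rw [mul_sub]; omega
  have hhi : (L : ℤ) * (y / L - x / L) < L * 1 := by rw [mul_sub]; omega
  have := lt_of_mul_lt_mul_left hlo hL.le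
  have := lt_of_mul_lt_mul_left hhi hL.le
  omega

/-- `g` is congruent modulo `L` to one of the values `T 0, …, T N`. -/
def IsCut (T : ℕ → ℤ) (N : ℕ) (L g : ℤ) : Prop :=
  ∃ a ≤ N, ∃ z, g = T a + L * z

theorem exists_isCut {T : ℕ → ℤ} {N : ℕ} {P L : ℤ} (hP : 0 < P) (hL : 0 < L) (h0 : T 0 = 0)
    (hN : T N = L) (hstep : ∀ k, T (k + 1) ≤ T k + P) (x : ℤ) :
    ∃ g, IsCut T N L g ∧ x ≤ g ∧ g < x + P := by
  classical
  have hr0 := Int.emod_nonneg x hL.ne'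
  have hrL := Int.emod_lt_of_pos x hL
  have hxd := Int.mul_ediv_add_emod x L
  have hex : ∃ a, x % L ≤ T a := ⟨N, by omega⟩
  refine ⟨T (Nat.find hex) + L * (x / L), ⟨_, Nat.find_min' hex (by omega), _, rfl⟩, ?_, ?_⟩
  · linarith [Nat.find_spec hex]
  · rcases h : Nat.find hex with _ | a
    · linarith
    · have := Nat.find_min hex (m := a) (by omega)
      linarith [hstep a]

theorem IsCut.emod_add_le {T : ℕ → ℤ} (hT : Monotone T) {N : ℕ} {L g : ℤ} (hg : IsCut T N L g)
    (h0 : T 0 = 0) (hN : T N = L) {k : ℕ} (hk : k < N) (hlt : T k < T (k + 1)) :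
    (T k - g) % L + (T (k + 1) - T k) ≤ L := by
  obtain ⟨a, ha, z, rfl⟩ := hg
  have hk0 := hT (Nat.zero_le k)
  have ha0 := hT (Nat.zero_le a)
  have hkN : T (k + 1) ≤ T N := hT hk
  have haN := hT ha
  rw [← sub_sub, Int.sub_mul_emod_self_left]
  rcases le_or_gt a k with hak | hka
  · have := hT hak
    rw [Int.emod_eq_of_lt (by omega) (by omega)]
    omega
  · have : T (k + 1) ≤ T a := hT hka
    rw [← Int.add_emod_right, Int.emod_eq_of_lt (by omega) (by omega)]
    omega

/-- Start offsets for the machines. The first two machines are shifted by exactly the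
maximum lead of the second over the first, every further one by at least `b`. -/
theorem exists_offsets {S : ℕ → ℕ → ℤ} {N : ℕ} {P L b : ℤ} (hN : 0 < N) (hP : 0 < P)
    (hL : 0 < L) (hmono : ∀ i, Monotone (S i)) (h0 : ∀ i, S i 0 = 0) (hSN : ∀ i, S i N = L)
    (hstep : ∀ i k, S i (k + 1) ≤ S i k + P)
    (hb : ∀ k < N, ∀ i i', S i (k + 1) - S i' k ≤ b) :
    ∃ g : ℕ → ℤ, (∀ i, IsCut (S i) N L (g i)) ∧
      ∀ i i', i < i' → (∀ k < N, S i' (k + 1) - S i k ≤ g i' - g i) ∧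
        g i' - g i ≤ i' * b + (i' - 1) * (P - 1) := by
  choose cut hcut hcut_ge hcut_lt using fun i =>
    exists_isCut (N := N) hP hL (h0 i) (hSN i) (hstep i)
  obtain ⟨k₀, hk₀, hmax⟩ := Finset.exists_max_image (Finset.range N)
    (fun k => S 1 (k + 1) - S 0 k) ⟨0, Finset.mem_range.2 hN⟩
  rw [Finset.mem_range] at hk₀
  let g : ℕ → ℤ := fun i => Nat.casesOn i (S 0 k₀) fun i =>
    Nat.rec (S 1 (k₀ + 1)) (fun j x => cut (j + 2) (x + b)) i
  have hg2 : ∀ i, g (i + 2) = cut (i + 2) (g (i + 1) + b) := fun _ => rfl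
  have hb0 : 0 ≤ b := by
    have := hb 0 hN 0 0
    have := hmono 0 (Nat.zero_le 1)
    simp only [zero_add] at *
    omega
  have h01 : ∀ k < N, S 1 (k + 1) - S 0 k ≤ g 1 - g 0 := fun k hk =>
    hmax k (Finset.mem_range.2 hk)
  have h01b : g 1 - g 0 ≤ b := hb k₀ hk₀ 1 0
  have h01' : g 0 ≤ g 1 := by
    have := h01 0 hN
    have := hmono 1 (Nat.zero_le (0 + 1))
    rw [h0] at *
    omega
  have hge : ∀ i, g (i + 1) + b ≤ g (i + 2) := fun i => hcut_ge _ _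
  have hlt : ∀ i, g (i + 2) < g (i + 1) + b + P := fun i => hcut_lt _ _
  have hgm : Monotone g := monotone_nat_of_le_succ fun i => by
    rcases i with _ | i
    · exact h01'
    · linarith [hge i]
  have hup : ∀ i, g (i + 1) - g 0 ≤ (i + 1) * b + i * (P - 1) := by
    intro i
    induction i with
    | zero => simpa using h01b
    | succ i ih => have := hlt i; push_cast; linarith
  refine ⟨g, ?_, ?_⟩
  · rintro (_ | _ | i)
    · exact ⟨k₀, hk₀.le, 0, by simp [g]⟩
    · exact ⟨k₀ + 1, hk₀, 0, by simp [g]⟩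
    · exact hcut _ _
  · rintro i (_ | i') hi
    · omega
    refine ⟨fun k hk => ?_, ?_⟩
    · rcases i' with _ | i'
      · obtain rfl : i = 0 := by omega
        exact h01 k hk
      · have := hgm (Nat.lt_succ_iff.1 hi)
        linarith [hb k hk (i' + 2) i, hge i']
    · have := hup i'
      push_cast
      linarith [hgm (Nat.zero_le i)]

theorem exists_schedule_of_offsets {m : ℕ} {J : Type*} {p : Fin m → J → ℕ} {e : ℕ → J} {N L : ℕ}
    (he : ∀ j, ∃ k < N, e k = j) (hL : ∀ i, ∑ t ∈ Finset.range N, p i (e t) = L)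
    {g : Fin m → ℤ}
    (hg : ∀ i, IsCut (fun k => ((∑ t ∈ Finset.range k, p i (e t) : ℕ) : ℤ)) N L (g i))
    (hlo : ∀ i i', i < i' → ∀ k < N, ((∑ t ∈ Finset.range (k + 1), p i' (e t) : ℕ) : ℤ) -
      (∑ t ∈ Finset.range k, p i (e t) : ℕ) ≤ g i' - g i)
    (hhi : ∀ i i', i < i' → ∀ k < N, ((∑ t ∈ Finset.range (k + 1), p i (e t) : ℕ) : ℤ) -
      (∑ t ∈ Finset.range k, p i' (e t) : ℕ) ≤ L - (g i' - g i)) :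
    ∃ s : Fin m → J → ℕ,
      (∀ i j j', j ≠ j' →
        Disjoint (Set.Ico (s i j) (s i j + p i j)) (Set.Ico (s i j') (s i j' + p i j'))) ∧
      (∀ j i i', i ≠ i' →
        Disjoint (Set.Ico (s i j) (s i j + p i j)) (Set.Ico (s i' j) (s i' j + p i' j))) ∧
      ∀ i j, 0 < p i j → s i j + p i j ≤ L := by
  choose κ hκN hκ using he
  let S : Fin m → ℕ → ℤ := fun i k => ((∑ t ∈ Finset.range k, p i (e t) : ℕ) : ℤ)
  have hmono : ∀ i, Monotone (S i) := fun i => monotone_nat_of_le_succ fun k => by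
    simp [S, Finset.sum_range_succ]
  have hsucc : ∀ i j, S i (κ j + 1) = S i (κ j) + p i j := fun i j => by
    simp [S, Finset.sum_range_succ, hκ]
  have hS0 : ∀ i, S i 0 = 0 := fun i => by simp [S]
  have hSN : ∀ i, S i N = L := fun i => by simp only [S, hL]
  have hmachine : ∀ i j j', κ j < κ j' →
      Disjoint (Set.Ico ((S i (κ j) - g i) % L).toNat (((S i (κ j) - g i) % L).toNat + p i j))
        (Set.Ico ((S i (κ j') - g i) % L).toNat
          (((S i (κ j') - g i) % L).toNat + p i j')) := fun i j j' hlt => by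
    have h1 : S i (κ j + 1) ≤ S i (κ j') := hmono i hlt
    have h2 : S i (κ j' + 1) ≤ S i N := hmono i (hκN j')
    have h3 := hmono i (Nat.zero_le (κ j))
    rw [hsucc] at h1 h2
    rw [hSN] at h2
    rw [hS0] at h3
    exact disjoint_Ico_emod (by linarith) (by linarith)
  have hjob : ∀ j i i', i < i' →
      Disjoint (Set.Ico ((S i (κ j) - g i) % L).toNat (((S i (κ j) - g i) % L).toNat + p i j))
        (Set.Ico ((S i' (κ j) - g i') % L).toNat
          (((S i' (κ j) - g i') % L).toNat + p i' j)) := fun j i i' hlt => by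
    have h1 : S i' (κ j + 1) - S i (κ j) ≤ g i' - g i := hlo i i' hlt _ (hκN j)
    have h2 : S i (κ j + 1) - S i' (κ j) ≤ L - (g i' - g i) := hhi i i' hlt _ (hκN j)
    rw [hsucc] at h1 h2
    exact (disjoint_Ico_emod (by linarith) (by linarith)).symm
  refine ⟨fun i j => ((S i (κ j) - g i) % L).toNat, fun i j j' hj => ?_, fun j i i' hi => ?_,
    fun i j hp => ?_⟩
  · rcases lt_trichotomy (κ j) (κ j') with h | h | h
    · exact hmachine i j j' h
    · exact absurd (by rw [← hκ j, ← hκ j', h]) hj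
    · exact (hmachine i j' j h).symm
  · rcases lt_or_gt_of_ne hi with h | h
    · exact hjob j i i' h
    · exact (hjob j i' i h).symm
  · have h := (hg i).emod_add_le (hmono i) (hS0 i) (hSN i) (hκN j) (by
      rw [hsucc]
      omega)
    have h' : (S i (κ j) - g i) % L + (S i (κ j + 1) - S i (κ j)) ≤ L := h
    rw [hsucc] at h'
    have hpos : (0 : ℤ) < L := by
      have h1 : S i (κ j + 1) ≤ S i N := hmono i (hκN j)
      have h2 := hmono i (Nat.zero_le (κ j))
      rw [hsucc, hSN] at h1
      rw [hS0] at h2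
      omega
    have := Int.emod_nonneg (S i (κ j) - g i) hpos.ne'
    change ((S i (κ j) - g i) % L).toNat + p i j ≤ L
    omega

theorem exists_schedule_of_equal_loads {m : ℕ} (hm : 1 ≤ m) {J : Type*} [Fintype J] [Nonempty J]
    {p : Fin m → J → ℕ} {P L : ℕ} (hP : 0 < P) (hpP : ∀ i j, p i j ≤ P)
    (hload : ∀ i, ∑ j, p i j = L) (hL : m ^ 2 * P ≤ L) :
    ∃ s : Fin m → J → ℕ,
      (∀ i j j', j ≠ j' →
        Disjoint (Set.Ico (s i j) (s i j + p i j)) (Set.Ico (s i j') (s i j' + p i j'))) ∧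
      (∀ j i i', i ≠ i' →
        Disjoint (Set.Ico (s i j) (s i j + p i j)) (Set.Ico (s i' j) (s i' j + p i' j))) ∧
      ∀ i j, 0 < p i j → s i j + p i j ≤ L := by
  obtain rfl | hm2 := hm.eq_or_lt
  · let f := Fintype.equivFin J
    let e : ℕ → J := fun k =>
      if h : k < Fintype.card J then f.symm ⟨k, h⟩ else Classical.arbitrary J
    have he : ∀ k : Fin (Fintype.card J), e k = f.symm k := fun k => by simp [e]
    refine exists_schedule_of_offsets (e := e) (N := Fintype.card J) (g := 0)
      (fun j => ⟨f j, (f j).2, by rw [he, f.symm_apply_apply]⟩) (fun i => ?_)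
      (fun i => ⟨0, Nat.zero_le _, 0, by simp⟩)
      (fun i i' hi => absurd (Subsingleton.elim i i') hi.ne)
      (fun i i' hi => absurd (Subsingleton.elim i i') hi.ne)
    rw [← hload i, Finset.sum_range]
    simp only [he]
    exact f.symm.sum_comp (p i)
  · obtain ⟨e, he, htot, hlead⟩ := exists_compact_order hm2 hpP hload
    let c : ℕ → Fin m := fun i => ⟨min i (m - 1), by omega⟩
    have hc : ∀ i : Fin m, c i = i := fun i => Fin.ext (min_eq_left (by omega))
    let S : ℕ → ℕ → ℤ := fun i k => ((∑ t ∈ Finset.range k, p (c i) (e t) : ℕ) : ℤ)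
    let b := (m * (m - 1) + 2) * P / m
    have hb : ∀ k < Fintype.card J, ∀ i i', S i (k + 1) - S i' k ≤ b := fun k hk i i' => by
      have h := hlead k hk (c i) (c i')
      rw [← Nat.sub_le_iff_le_add', ← Nat.mul_sub, mul_comm,
        ← Nat.le_div_iff_mul_le (by omega)] at h
      simp only [S, b]
      omega
    have hmb : m * b ≤ (m * (m - 1) + 2) * P := Nat.mul_div_le _ _
    have hbound : (m : ℤ) * b + (m - 2) * (P - 1) ≤ L := by
      obtain ⟨r, rfl⟩ := Nat.exists_eq_add_of_le hm2
      have h1 : (((1 + 1 + r : ℕ) : ℤ)) * b ≤ ((1 + 1 + r : ℕ) * (1 + r : ℕ) + 2) * P := by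
        rw [show 1 + 1 + r - 1 = 1 + r by omega] at hmb
        exact_mod_cast hmb
      have h2 : (((1 + 1 + r : ℕ) : ℤ)) ^ 2 * P ≤ L := by exact_mod_cast hL
      push_cast at h1 h2 ⊢
      linarith [Int.natCast_nonneg r]
    have hLpos : 0 < L := lt_of_lt_of_le (by positivity) hL
    obtain ⟨g, hg, hpair⟩ := exists_offsets (S := S) (N := Fintype.card J) (P := P) (L := L)
      (b := b) Fintype.card_pos (by exact_mod_cast hP) (by exact_mod_cast hLpos)
      (fun i => monotone_nat_of_le_succ fun k => by simp [S, Finset.sum_range_succ])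
      (fun i => by simp [S]) (fun i => by simp only [S, htot])
      (fun i k => by simpa [S, Finset.sum_range_succ] using hpP _ _) hb
    simp only [S] at hg hpair hb
    refine exists_schedule_of_offsets (g := fun i => g i) he htot (fun i => ?_)
      (fun i i' hi k hk => ?_) (fun i i' hi k hk => ?_)
    · simpa only [hc] using hg i
    · simpa only [hc] using (hpair i i' hi).1 k hk
    · have h1 := (hpair i i' hi).2
      have h2 := hb k hk i i'
      simp only [hc] at h2
      have hi' : ((i' : ℕ) : ℤ) ≤ m - 1 := by omega
      have hP1 : (0 : ℤ) ≤ P - 1 := by omega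
      have h3 := mul_le_mul_of_nonneg_right hi' (Int.natCast_nonneg b)
      have h4 := mul_le_mul_of_nonneg_right
        (show ((i' : ℕ) : ℤ) - 1 ≤ m - 2 by omega) hP1
      linarith

/-- A schedule of length `L` exists if `L` bounds all machine loads and is at least `m ^ 2` times
a bound on the processing times. -/
theorem exists_schedule {m : ℕ} (hm : 1 ≤ m) {J : Type*} [Fintype J] [Nonempty J]
    {p : Fin m → J → ℕ} {P L : ℕ} (hP : 0 < P) (hpP : ∀ i j, p i j ≤ P)
    (hload : ∀ i, ∑ j, p i j ≤ L) (hL : m ^ 2 * P ≤ L) :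
    ∃ s : Fin m → J → ℕ,
      (∀ i j j', j ≠ j' →
        Disjoint (Set.Ico (s i j) (s i j + p i j)) (Set.Ico (s i j') (s i j' + p i j'))) ∧
      (∀ j i i', i ≠ i' →
        Disjoint (Set.Ico (s i j) (s i j + p i j)) (Set.Ico (s i' j) (s i' j + p i' j))) ∧
      ∀ i j, 0 < p i j → s i j + p i j ≤ L := by
  let q : Fin m → J ⊕ (Fin m × Fin L) → ℕ := fun i =>
    Sum.elim (p i) fun d => if i = d.1 ∧ (d.2 : ℕ) < L - ∑ j, p i j then 1 else 0
  have hqP : ∀ i j, q i j ≤ P := by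
    rintro i (j | d)
    · exact hpP i j
    · simp only [q, Sum.elim_inr]
      split_ifs <;> omega
  have hqL : ∀ i, ∑ j, q i j = L := fun i => by
    have hcard : (Finset.univ.filter fun t : Fin L => (t : ℕ) < L - ∑ j, p i j).card =
        L - ∑ j, p i j := by
      rw [Fin.card_filter_val_lt, min_eq_right (Nat.sub_le _ _)]
    have hdummy : ∑ d : Fin m × Fin L,
        (if i = d.1 ∧ (d.2 : ℕ) < L - ∑ j, p i j then 1 else 0) = L - ∑ j, p i j := by
      rw [Fintype.sum_prod_type, Finset.sum_eq_single i (fun i' _ hi => by simp [hi.symm])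
        (by simp)]
      simpa using hcard
    simp only [q, Fintype.sum_sum_type, Sum.elim_inl, Sum.elim_inr, hdummy]
    exact Nat.add_sub_cancel' (hload i)
  obtain ⟨s, h1, h2, h3⟩ := exists_schedule_of_equal_loads hm hP hqP hqL hL
  exact ⟨fun i j => s i (.inl j), fun i j j' hj => h1 i _ _ (Sum.inl_injective.ne hj),
    fun j => h2 (.inl j), fun i j => h3 i (.inl j)⟩

/-- No feasible schedule is shorter than the maximum machine load. -/
theorem OSFeasible.maxLoad_le_makespan {m n : ℕ} {p s : Fin m → Fin n → ℕ}
    (h : OSFeasible m n p s) : OSMaxLoad m n p ≤ OSMakespan m n p s := by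
  refine Finset.sup_le fun i _ => ?_
  have hsub : (Finset.univ.filter fun j => 0 < p i j).biUnion
      (fun j => Finset.Ico (s i j) (s i j + p i j)) ⊆ Finset.range (OSMakespan m n p s) := by
    intro t ht
    obtain ⟨j, hj, ht⟩ := Finset.mem_biUnion.1 ht
    have hle := Finset.le_sup (f := fun ij : Fin m × Fin n =>
      if 0 < p ij.1 ij.2 then s ij.1 ij.2 + p ij.1 ij.2 else 0) (Finset.mem_univ (i, j))
    simp only [(Finset.mem_filter.1 hj).2, if_true] at hle
    exact Finset.mem_range.2 ((Finset.mem_Ico.1 ht).2.trans_le hle)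
  have hcard := Finset.card_le_card hsub
  rw [Finset.card_biUnion fun j hj j' hj' hne => by
    rw [Function.onFun, ← Finset.disjoint_coe, Finset.coe_Ico, Finset.coe_Ico]
    exact h.1 i j j' hne (Finset.mem_filter.1 hj).2 (Finset.mem_filter.1 hj').2] at hcard
  simp only [Nat.card_Ico, Nat.add_sub_cancel_left, Finset.card_range] at hcard
  rwa [Finset.sum_filter_of_ne fun j _ hj => Nat.pos_of_ne_zero hj] at hcard

/-- (Sevastianov) If the maximum machine load satisfies `ℓ_max ≥ m² · p_max`, then there
is a feasible open shop schedule with makespan exactly `ℓ_max`; consequently, the minimum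
makespan over all feasible schedules equals `ℓ_max`. -/
theorem sevastianov_openShop (m n : ℕ) (hm : 1 ≤ m) (hn : 1 ≤ n)
    (p : Fin m → Fin n → ℕ) (hload : m ^ 2 * OSPMax m n p ≤ OSMaxLoad m n p) :
    (∃ s : Fin m → Fin n → ℕ, OSFeasible m n p s ∧ OSMakespan m n p s = OSMaxLoad m n p) ∧
      IsLeast {C : ℕ | ∃ s : Fin m → Fin n → ℕ, OSFeasible m n p s ∧ OSMakespan m n p s = C}
        (OSMaxLoad m n p) := by
  obtain ⟨s, hs, hle⟩ : ∃ s, OSFeasible m n p s ∧ OSMakespan m n p s ≤ OSMaxLoad m n p := by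
    have hpP : ∀ i j, p i j ≤ OSPMax m n p := fun i j =>
      Finset.le_sup (f := fun ij : Fin m × Fin n => p ij.1 ij.2) (Finset.mem_univ (i, j))
    rcases Nat.eq_zero_or_pos (OSPMax m n p) with hP | hP
    · have hp0 : ∀ i j, p i j = 0 := fun i j => Nat.le_zero.1 (hP ▸ hpP i j)
      exact ⟨0, by simp [OSFeasible, hp0], by simp [OSMakespan, hp0]⟩
    · have : Nonempty (Fin n) := ⟨⟨0, hn⟩⟩
      obtain ⟨s, h1, h2, h3⟩ := exists_schedule hm hP hpP
        (fun i => Finset.le_sup (f := fun i => ∑ j, p i j) (Finset.mem_univ i)) hload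
      refine ⟨s, ⟨fun i j j' hj _ _ => h1 i j j' hj, fun j i i' hi _ _ => h2 j i i' hi⟩,
        Finset.sup_le fun ij _ => ?_⟩
      split_ifs with h
      · exact h3 _ _ h
      · exact Nat.zero_le _
  have heq := hle.antisymm hs.maxLoad_le_makespan
  exact ⟨⟨s, hs, heq⟩, ⟨s, hs, heq⟩, by
    rintro _ ⟨s', hs', rfl⟩
    exact hs'.maxLoad_le_makespan⟩
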